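/- arXiv:2506.14002 — 2 statements merged into one kernel-verified Lean document; each statement's English description precedes it below -/
import Mathlib

section
/- Markov-type bound on the number of large sparse inner products. Let G be an N×m real matrix whose rows g_1,…,g_N satisfy ‖g_l‖₂ ≤ 1, and suppose every column of G has at most k nonzero entries. Then for every Δ ∈ ℝ^m and every ϱ > 0, Σ_{l=1}^N 1{ g_l^⊤ Δ > ϱ } ≤ (k / ϱ²) · ‖Δ‖₂². -/
/-- Markov-type bound on the number of large sparse inner products: if every row of the
`N × m` matrix `G` has ℓ2-norm at most 1 and every column has at most `k` nonzero entries,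
then for every `Δ ∈ ℝ^m` and `ϱ > 0`, `Σ_l 1{g_lᵀΔ > ϱ} ≤ (k/ϱ²)·‖Δ‖₂²`. -/
theorem sparse_markov_large_inner_products (N m k : ℕ) (G : Fin N → Fin m → ℝ)
    (hrow : ∀ l, Real.sqrt (∑ i, G l i ^ 2) ≤ 1)
    (hcol : ∀ i, (Function.support fun l => G l i).ncard ≤ k)
    (Δ : Fin m → ℝ) (ϱ : ℝ) (hϱ : 0 < ϱ) :
    (∑ l, if ϱ < ∑ i, G l i * Δ i then (1 : ℝ) else 0) ≤
      ((k : ℝ) / ϱ ^ 2) * ∑ i, Δ i ^ 2 := by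
  classical
  have key : ∀ l, (if ϱ < ∑ i, G l i * Δ i then (1 : ℝ) else 0) * ϱ ^ 2 ≤
      ∑ i, (if G l i ≠ 0 then Δ i ^ 2 else 0) := by
    intro l
    have hnn : 0 ≤ ∑ i, (if G l i ≠ 0 then Δ i ^ 2 else 0) :=
      Finset.sum_nonneg fun i _ => by split_ifs <;> positivity
    split_ifs with h
    · have hcs := Finset.sum_mul_sq_le_sq_mul_sq Finset.univ (G l)
        (fun i => if G l i ≠ 0 then Δ i else 0)
      have e1 : ∑ i, G l i * (if G l i ≠ 0 then Δ i else 0) = ∑ i, G l i * Δ i :=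
        Finset.sum_congr rfl fun i _ => by
          by_cases hz : G l i = 0 <;> simp [hz]
      have e2 : ∑ i, (if G l i ≠ 0 then Δ i else 0) ^ 2 =
          ∑ i, (if G l i ≠ 0 then Δ i ^ 2 else 0) :=
        Finset.sum_congr rfl fun i _ => by
          by_cases hz : G l i = 0 <;> simp [hz]
      rw [e1, e2] at hcs
      have h1 : ∑ i, G l i ^ 2 ≤ 1 := Real.sqrt_le_one.mp (hrow l)
      have h2 := mul_le_mul_of_nonneg_right h1 hnn
      have h3 : ϱ ^ 2 ≤ (∑ i, G l i * Δ i) ^ 2 := pow_le_pow_left₀ hϱ.le h.le 2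
      linarith
    · simpa using hnn
  have hcol2 : ∀ i, ∑ l, (if G l i ≠ 0 then Δ i ^ 2 else 0) ≤ (k : ℝ) * Δ i ^ 2 := by
    intro i
    have hc : (Finset.univ.filter fun l => G l i ≠ 0).card ≤ k := by
      rw [← Set.ncard_coe_finset]
      convert hcol i using 2
      ext l
      simp
    rw [← Finset.sum_filter, Finset.sum_const, nsmul_eq_mul]
    exact mul_le_mul_of_nonneg_right (by exact_mod_cast hc) (sq_nonneg _)
  rw [div_mul_eq_mul_div, le_div_iff₀ (by positivity), Finset.sum_mul, Finset.mul_sum]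
  calc _ ≤ ∑ l, ∑ i, (if G l i ≠ 0 then Δ i ^ 2 else 0) := Finset.sum_le_sum fun l _ => key l
    _ = ∑ i, ∑ l, (if G l i ≠ 0 then Δ i ^ 2 else 0) := Finset.sum_comm
    _ ≤ _ := Finset.sum_le_sum fun i _ => hcol2 i
end

section
/- Combinatorial bound on doubly co-occurring row pairs. Let H be an N×n real matrix, and for j ∈ {1,…,n} let D_j = { l : H_{l,j} ≠ 0 }. Assume: every row of H has at most s nonzero entries; |D_j| ≤ ρ₁ N for every j; and |D_i ∩ D_j| ≤ ρ₁ ρ₂ N for all i ≠ j. Then (1/N²) Σ_{j=1}^n Σ_{l ∈ D_j} Σ_{l′ ∈ D_j} 1{ the rows l and l′ of H have at least two common nonzero coordinates } ≤ s² ρ₁ ρ₂. -/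
/-- Combinatorial bound on doubly co-occurring row pairs.  Let `H` be an `N × n` matrix
with `D_j = {l : H_{l,j} ≠ 0}`, every row having at most `s` nonzero entries,
`|D_j| ≤ ρ₁N` for every `j`, and `|D_i ∩ D_j| ≤ ρ₁ρ₂N` for all `i ≠ j`.  Then
`(1/N²)·Σ_j Σ_{l∈D_j} Σ_{l'∈D_j} 1{rows l, l' share ≥ 2 common nonzero coordinates}
  ≤ s²ρ₁ρ₂`. -/
theorem doubly_cooccurring_pairs_bound (N n s : ℕ) (hN : 1 ≤ N) (ρ₁ ρ₂ : ℝ)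
    (hρ₁ : 0 ≤ ρ₁) (hρ₂ : 0 ≤ ρ₂)
    (H : Fin N → Fin n → ℝ)
    (hrow0 : ∀ l, (Function.support (H l)).ncard ≤ s)
    (hcol : ∀ j : Fin n,
      (((Finset.univ.filter fun l => H l j ≠ 0)).card : ℝ) ≤ ρ₁ * N)
    (hco : ∀ i j : Fin n, i ≠ j →
      ((((Finset.univ.filter fun l => H l i ≠ 0)) ∩
          (Finset.univ.filter fun l => H l j ≠ 0)).card : ℝ) ≤ ρ₁ * ρ₂ * N) :
    (1 / (N : ℝ) ^ 2) * ∑ j : Fin n, ∑ l ∈ Finset.univ.filter (fun l => H l j ≠ 0),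
        ∑ l' ∈ Finset.univ.filter (fun l => H l j ≠ 0),
          (if ∃ i i' : Fin n, i ≠ i' ∧ H l i ≠ 0 ∧ H l' i ≠ 0 ∧ H l i' ≠ 0 ∧ H l' i' ≠ 0
            then (1 : ℝ) else 0) ≤
      (s : ℝ) ^ 2 * ρ₁ * ρ₂ := by
  classical
  set a : Fin N → Fin n → ℝ := fun l j => if H l j ≠ 0 then 1 else 0 with ha
  have ha0 : ∀ l j, 0 ≤ a l j := fun l j => by simp only [ha]; split_ifs <;> norm_num
  have hNpos : (0 : ℝ) < N := by exact_mod_cast hN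
  have hc : ∀ i j, i ≠ j → ∑ l, a l i * a l j ≤ ρ₁ * ρ₂ * N := by
    intro i j hij
    refine le_trans (le_of_eq ?_) (hco i j hij)
    rw [← Finset.filter_and, Finset.card_filter]
    push_cast
    refine Finset.sum_congr rfl fun l _ => ?_
    simp only [ha]
    by_cases h1 : H l i = 0 <;> by_cases h2 : H l j = 0 <;> simp [h1, h2]
  have hrow : ∀ l, ∑ j, a l j ≤ s := by
    intro l
    have h : ((Function.support (H l)).ncard : ℝ) ≤ s := by exact_mod_cast hrow0 l
    refine le_trans (le_of_eq ?_) h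
    have e : Function.support (H l) = ↑(Finset.univ.filter fun j => H l j ≠ 0) := by
      ext j; simp
    rw [e, Set.ncard_coe_finset, Finset.card_filter]
    push_cast
    rfl
  have hK : 0 ≤ ρ₁ * ρ₂ * N := by positivity
  have key : ∀ j : Fin n, ∑ l ∈ Finset.univ.filter (fun l => H l j ≠ 0),
        ∑ l' ∈ Finset.univ.filter (fun l => H l j ≠ 0),
          (if ∃ i i' : Fin n, i ≠ i' ∧ H l i ≠ 0 ∧ H l' i ≠ 0 ∧ H l i' ≠ 0 ∧ H l' i' ≠ 0
            then (1 : ℝ) else 0) ≤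
      ∑ i, ρ₁ * ρ₂ * N * ∑ l, a l i * a l j := by
    intro j
    calc _ ≤ ∑ l, ∑ l', ∑ i, (if i ≠ j then (a l i * a l j) * (a l' i * a l' j) else 0) := by
          rw [Finset.sum_filter]
          refine Finset.sum_le_sum fun l _ => ?_
          have hnn : ∀ l' i, 0 ≤ (if i ≠ j then (a l i * a l j) * (a l' i * a l' j) else 0) := by
            intro l' i
            split_ifs
            · exact mul_nonneg (mul_nonneg (ha0 _ _) (ha0 _ _)) (mul_nonneg (ha0 _ _) (ha0 _ _))
            · exact le_rfl
          split_ifs with hl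
          · rw [Finset.sum_filter]
            refine Finset.sum_le_sum fun l' _ => ?_
            split_ifs with hl' hex
            · obtain ⟨i, hij, h1, h2⟩ : ∃ i, i ≠ j ∧ H l i ≠ 0 ∧ H l' i ≠ 0 := by
                obtain ⟨i, i', hii, h1, h2, h3, h4⟩ := hex
                by_cases h : i = j
                · exact ⟨i', fun h' => hii (h.trans h'.symm), h3, h4⟩
                · exact ⟨i, h, h1, h2⟩
              refine le_trans (le_of_eq ?_)
                (Finset.single_le_sum (fun i _ => hnn l' i) (Finset.mem_univ i))
              simp [ha, hij, h1, h2, hl, hl']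
            · exact Finset.sum_nonneg fun i _ => hnn l' i
            · exact Finset.sum_nonneg fun i _ => hnn l' i
          · exact Finset.sum_nonneg fun l' _ => Finset.sum_nonneg fun i _ => hnn l' i
      _ = ∑ i, if i ≠ j then (∑ l, a l i * a l j) * (∑ l, a l i * a l j) else 0 := by
          rw [Finset.sum_congr rfl fun l _ => Finset.sum_comm, Finset.sum_comm]
          refine Finset.sum_congr rfl fun i _ => ?_
          split_ifs
          · rw [Finset.sum_mul_sum]
          · simp
      _ ≤ _ := by
          refine Finset.sum_le_sum fun i _ => ?_
          have h0 : 0 ≤ ∑ l, a l i * a l j :=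
            Finset.sum_nonneg fun l _ => mul_nonneg (ha0 _ _) (ha0 _ _)
          split_ifs with h
          · exact mul_le_mul_of_nonneg_right (hc i j h) h0
          · exact mul_nonneg hK h0
  have tot : ∑ j, ∑ i, ∑ l, a l i * a l j ≤ N * (s : ℝ) ^ 2 := by
    calc _ = ∑ l, (∑ j, a l j) * (∑ j, a l j) := by
          rw [Finset.sum_congr rfl fun j _ => Finset.sum_comm, Finset.sum_comm]
          refine Finset.sum_congr rfl fun l _ => ?_
          rw [Finset.sum_mul_sum, Finset.sum_comm]
      _ ≤ ∑ l : Fin N, (s : ℝ) ^ 2 := by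
          refine Finset.sum_le_sum fun l _ => ?_
          rw [pow_two]
          exact mul_le_mul (hrow l) (hrow l) (Finset.sum_nonneg fun j _ => ha0 l j) (by positivity)
      _ = _ := by simp
  have fin := (Finset.sum_le_sum fun j (_ : j ∈ Finset.univ) => key j)
  simp only [← Finset.mul_sum] at fin
  have fin2 := fin.trans (mul_le_mul_of_nonneg_left tot hK)
  rw [one_div, inv_mul_le_iff₀ (by positivity)]
  refine le_trans (le_of_eq ?_) (fin2.trans (le_of_eq (by ring)))
  refine Finset.sum_congr rfl fun j _ => Finset.sum_congr rfl fun l _ =>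
    Finset.sum_congr rfl fun l' _ => ?_
  congr
end
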